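/- Let d ≥ 2, n ≥ 2, and t ≥ 2 with n ≤ 2t−2. Then the directed de Bruijn graph B⃗(d,n) has no t-identifying code. -/

import Mathlib

/- Common framework: the directed de Bruijn graph B⃗(d,n).
Vertices are strings of length `n` over the alphabet `A_d = Fin d`,
modelled as functions `Fin n → Fin d` (0-indexed; the paper's 1-indexed
position `i` corresponds to index `i - 1` here). -/

namespace DeBruijnPaper

/-- Vertices of the directed de Bruijn graph: strings of length `n` over `Fin d`. -/
abbrev Vtx (d n : ℕ) := Fin n → Fin d

/-- Directed edge from `x = x₁⋯xₙ` to `y = y₁⋯yₙ`: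
`x₂x₃⋯xₙ = y₁y₂⋯y_{n−1}`. -/
def adj (d n : ℕ) (x y : Vtx d n) : Prop :=
  ∀ (i : ℕ) (h : i + 1 < n), x ⟨i + 1, h⟩ = y ⟨i, by omega⟩

/-- There is a directed walk of length `t` from `x` to `y`. -/
def hasWalk (d n : ℕ) (t : ℕ) (x y : Vtx d n) : Prop :=
  ∃ f : ℕ → Vtx d n, f 0 = x ∧ f t = y ∧ ∀ i < t, adj d n (f i) (f (i + 1))

/-- Directed distance `d⃗(x,y)`: the length of a shortest directed path
(equivalently walk) from `x` to `y`. -/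
noncomputable def dirDist (d n : ℕ) (x y : Vtx d n) : ℕ :=
  sInf {t : ℕ | hasWalk d n t x y}

/-- The in-ball `B_t^−(v) = {u : d⃗(u,v) ≤ t}`. -/
def inBall (d n t : ℕ) (v : Vtx d n) : Set (Vtx d n) :=
  {u : Vtx d n | dirDist d n u v ≤ t}

/-- `S` is a `t`-identifying code: every vertex has a nonempty identifying set
`B_t^−(v) ∩ S`, and distinct vertices have distinct identifying sets. -/
def IsIdCode (d n t : ℕ) (S : Set (Vtx d n)) : Prop :=
  (∀ v : Vtx d n, (inBall d n t v ∩ S).Nonempty) ∧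
    ∀ u v : Vtx d n, u ≠ v → inBall d n t u ∩ S ≠ inBall d n t v ∩ S

/-- `S` is a (directed) `t`-dominating set. -/
def IsDomSet (d n t : ℕ) (S : Set (Vtx d n)) : Prop :=
  ∀ v : Vtx d n, (inBall d n t v ∩ S).Nonempty

/-- `S` is a directed resolving set. -/
def IsResolving (d n : ℕ) (S : Set (Vtx d n)) : Prop :=
  ∀ u v : Vtx d n, u ≠ v → ∃ s ∈ S, dirDist d n s u ≠ dirDist d n s v

/-- The directed metric dimension: minimum size of a directed resolving set. -/
noncomputable def metricDim (d n : ℕ) : ℕ :=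
  sInf {k : ℕ | ∃ S : Set (Vtx d n), IsResolving d n S ∧ S.ncard = k}

/-- `π` is an automorphism of the directed de Bruijn graph. -/
def IsAut (d n : ℕ) (π : Equiv.Perm (Vtx d n)) : Prop :=
  ∀ x y : Vtx d n, adj d n x y ↔ adj d n (π x) (π y)

/-- `S` is a determining set. -/
def IsDetSet (d n : ℕ) (S : Set (Vtx d n)) : Prop :=
  ∀ π : Equiv.Perm (Vtx d n), IsAut d n π → (∀ s ∈ S, π s = s) → π = 1

/-- The determining number: minimum size of a determining set. -/
noncomputable def detNum (d n : ℕ) : ℕ :=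
  sInf {k : ℕ | ∃ S : Set (Vtx d n), IsDetSet d n S ∧ S.ncard = k}

/-- `w` (of length `N`) has period length `ℓ` (a positive period is intended):
`N ≥ 2ℓ` and `w_i = w_{i+ℓ}` for all valid `i` (paper is 1-indexed, here 0-indexed). -/
def HasPeriod {d N : ℕ} (w : Fin N → Fin d) (ℓ : ℕ) : Prop :=
  2 * ℓ ≤ N ∧ ∀ (i : ℕ) (h : i + ℓ < N), w ⟨i, by omega⟩ = w ⟨i + ℓ, h⟩

/-- `w` is `ℓ`-periodic: it has period length `ℓ` but no (positive) period length `k < ℓ`. -/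
def IsPeriodic {d N : ℕ} (w : Fin N → Fin d) (ℓ : ℕ) : Prop :=
  HasPeriod w ℓ ∧ ∀ k : ℕ, 1 ≤ k → k < ℓ → ¬ HasPeriod w k

/-- `w` is almost `ℓ`-periodic: `ℓ > N/2` and some extension `w ⊕ w'` of length `2ℓ`
is `ℓ`-periodic. -/
def AlmostPeriodic {d N : ℕ} (w : Fin N → Fin d) (ℓ : ℕ) : Prop :=
  N < 2 * ℓ ∧ ∃ w' : Fin (2 * ℓ - N) → Fin d, IsPeriodic (Fin.append w w') ℓ

/-- `w^{(k,m)}` where `k` is the 0-indexed position: add `m` (mod `d`) to the `k`-th letter.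
(The paper's 1-indexed `w^{(k,m)}` is `modify w (k-1) m` here.) -/
def modify {d N : ℕ} (w : Fin N → Fin d) (k : ℕ) (m : Fin d) : Fin N → Fin d :=
  fun i => if i.val = k then w i + m else w i

/-- `w(a:b)`: the substring `w_a w_{a+1} ⋯ w_b`, with `a`, `b` 1-indexed as in the paper. -/
def substr {d N : ℕ} (w : Fin N → Fin d) (a b : ℕ) (ha : 1 ≤ a) (hb : b ≤ N) :
    Fin (b + 1 - a) → Fin d :=
  fun i => w ⟨a - 1 + i.val, by have := i.isLt; omega⟩

theorem adj_walk_apply {d n t : ℕ} {f : ℕ → Vtx d n}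
    (hf : ∀ i < t, adj d n (f i) (f (i + 1))) (s : ℕ) (hs : s ≤ t) (i : ℕ) (h : i + s < n) :
    f 0 ⟨i + s, h⟩ = f s ⟨i, by omega⟩ := by
  induction s generalizing i with
  | zero => rfl
  | succ s ih =>
    rw [← hf s (by omega) i (by omega), ← ih (by omega) (i + 1) (by omega)]
    congr 2
    omega

/-- There is a walk of length `k` from `x` to `y` exactly when the last `n - k` letters of `x`
are the first `n - k` letters of `y`. -/
theorem hasWalk_iff {d n k : ℕ} (hn : 0 < n) (x y : Vtx d n) :
    hasWalk d n k x y ↔ ∀ (i : ℕ) (h : i + k < n), x ⟨i + k, h⟩ = y ⟨i, by omega⟩ := by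
  constructor
  · rintro ⟨f, rfl, rfl, hf⟩ i h
    exact adj_walk_apply hf k le_rfl i h
  · intro hxy
    let g : ℕ → Fin d := fun m =>
      if h : m < n then x ⟨m, h⟩ else if h : m - k < n then y ⟨m - k, h⟩ else x ⟨0, hn⟩
    refine ⟨fun s i => g (i + s), ?_, ?_, ?_⟩
    · funext i
      simp [g]
    · funext ⟨i, hi⟩
      by_cases h : i + k < n
      · simp [g, h, hxy i h]
      · simp [g, h, hi]
    · intro s _ i _
      change g (i + 1 + s) = g (i + (s + 1))
      congr 1
      omega

theorem mem_inBall_iff {d n t : ℕ} (hn : 0 < n) (x y : Vtx d n) :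
    x ∈ inBall d n t y ↔
      ∃ k ≤ t, ∀ (i : ℕ) (h : i + k < n), x ⟨i + k, h⟩ = y ⟨i, by omega⟩ := by
  have hne : {k | hasWalk d n k x y}.Nonempty :=
    ⟨n, (hasWalk_iff hn x y).2 fun i h => absurd h (by omega)⟩
  constructor
  · intro h
    exact ⟨_, h, (hasWalk_iff hn x y).1 (Nat.sInf_mem hne)⟩
  · rintro ⟨k, hk, h⟩
    exact (Nat.sInf_le ((hasWalk_iff hn x y).2 h)).trans hk

/-- Two words that agree except possibly in their last letter, the first of which belongs to
the in-ball of the second, satisfy an inclusion of in-balls. -/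
theorem inBall_subset_of_agree {d n t : ℕ} (hn : 0 < n) {v w : Vtx d n}
    (hagree : ∀ (i : ℕ) (h : i + 1 < n), v ⟨i, by omega⟩ = w ⟨i, by omega⟩)
    (hmem : v ∈ inBall d n t w) : inBall d n t v ⊆ inBall d n t w := by
  intro x hx
  obtain ⟨k, hk, h⟩ := (mem_inBall_iff hn x v).1 hx
  rcases Nat.eq_zero_or_pos k with rfl | hpos
  · have hxv : x = v := funext fun i => h i.1 i.2
    exact hxv ▸ hmem
  · exact (mem_inBall_iff hn x w).2
      ⟨k, hk, fun i hi => (h i hi).trans (hagree i (by omega))⟩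

/-- For `n ≤ 2t − 2`, some two distinct vertices have the same in-ball of radius `t`. With
`m = n - t`, they are the words `0^m 1 0^(n-m-1)` and `0^m 1 0^(n-m-2) 1`. -/
theorem exists_ne_inBall_eq {d n t : ℕ} (hd : 2 ≤ d) (hn : 2 ≤ n) (hnt : n ≤ 2 * t - 2) :
    ∃ v w : Vtx d n, v ≠ w ∧ inBall d n t v = inBall d n t w := by
  have hpos : 0 < n := by omega
  let a : Fin d := ⟨0, by omega⟩
  let b : Fin d := ⟨1, by omega⟩
  have hab : a ≠ b := by simp [a, b]
  let v : Vtx d n := fun i => if i.1 = n - t then b else a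
  let w : Vtx d n := fun i => if i.1 = n - t ∨ i.1 = n - 1 then b else a
  have hagree (i : ℕ) (h : i + 1 < n) : v ⟨i, by omega⟩ = w ⟨i, by omega⟩ := by
    have h1 : i ≠ n - 1 := by omega
    simp [v, w, h1]
  refine ⟨v, w, ?_, ?_⟩
  · intro h
    have hlast := congrFun h ⟨n - 1, by omega⟩
    have h1 : n - 1 ≠ n - t := by omega
    simp [v, w, h1, hab] at hlast
  · apply Set.Subset.antisymm
    · refine inBall_subset_of_agree hpos hagree ((mem_inBall_iff hpos v w).2 ⟨t, le_rfl, ?_⟩)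
      intro i h
      have h1 : i + t ≠ n - t := by omega
      have h2 : ¬(i = n - t ∨ i = n - 1) := by omega
      simp only [v, w, h1, h2, if_false]
    · refine inBall_subset_of_agree hpos (fun i h => (hagree i h).symm)
        ((mem_inBall_iff hpos w v).2 ⟨t - 1, by omega, ?_⟩)
      intro i h
      have h1 : (i + (t - 1) = n - t ∨ i + (t - 1) = n - 1) ↔ i = n - t := by omega
      simp only [v, w, h1]

/-- Theorem `MPT12`: for `n ≤ 2t − 2` there is no `t`-identifying code
in `B⃗(d,n)`. -/
theorem stmt6 (d n t : ℕ) (hd : 2 ≤ d) (hn : 2 ≤ n) (ht : 2 ≤ t) (hnt : n ≤ 2 * t - 2) :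
    ¬ ∃ S : Set (Vtx d n), IsIdCode d n t S := by
  rintro ⟨S, -, hS⟩
  obtain ⟨v, w, hvw, h⟩ := exists_ne_inBall_eq hd hn hnt
  exact hS v w hvw (by rw [h])

end DeBruijnPaper
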